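/- If G is a graph such that the essential spectrum of the normalized Laplacian Δ_η equals {1}, then there exist two infinite sequences of eigenvalues (λ_n⁺) and (λ_n⁻) of Δ_η with λ_n⁺ > 1 and λ_n⁻ < 1 for all n (both converging to 1). -/

import Mathlib

open scoped ComplexInnerProductSpace

variable {H : Type*} [NormedAddCommGroup H] [InnerProductSpace ℂ H] [CompleteSpace H]

/-- The essential spectrum of a self-adjoint operator, characterized by
Weyl (orthonormal singular) sequences. -/
def essSpec (A : H →L[ℂ] H) : Set ℝ :=
  {t | ∃ u : ℕ → H, (∀ n, ‖u n‖ = 1) ∧ (∀ i j, i ≠ j → ⟪u i, u j⟫ = 0) ∧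
    Filter.Tendsto (fun n => ‖A (u n) - (t : ℂ) • u n‖) Filter.atTop (nhds 0)}

/-- Off the essential spectrum, `A - t` is bounded below off a finite-dimensional subspace. -/
theorem bddBelow_of_notMem_essSpec (A : H →L[ℂ] H) (t : ℝ) (ht : t ∉ essSpec A) :
    ∃ (F : Submodule ℂ H) (c : ℝ), FiniteDimensional ℂ F ∧ 0 < c ∧
      ∀ x ∈ Fᗮ, c * ‖x‖ ≤ ‖A x - (t : ℂ) • x‖ := by
  by_contra hcon
  push Not at hcon
  apply ht
  have key : ∀ s : Finset (ℕ × H),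
      (∀ x ∈ s, ‖x.2‖ = 1 ∧ ‖A x.2 - (t : ℂ) • x.2‖ < 1 / ((x.1 : ℝ) + 1)) →
      ∃ y : ℕ × H, (‖y.2‖ = 1 ∧ ‖A y.2 - (t : ℂ) • y.2‖ < 1 / ((y.1 : ℝ) + 1)) ∧
        ∀ x ∈ s, (⟪x.2, y.2⟫ = 0 ∧ x.1 < y.1) := by
    intro s _
    classical
    let k : ℕ := s.sup Prod.fst + 1
    obtain ⟨x, hxF, hx⟩ := hcon (Submodule.span ℂ ((s.image Prod.snd : Finset H) : Set H))
      (1 / ((k : ℝ) + 1)) (FiniteDimensional.span_finset ℂ _) (by positivity)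
    have hx0 : x ≠ 0 := by
      rintro rfl
      simp at hx
    have hxn : 0 < ‖x‖ := norm_pos_iff.2 hx0
    refine ⟨(k, ((‖x‖⁻¹ : ℝ) : ℂ) • x), ⟨?_, ?_⟩, ?_⟩
    · simp [norm_smul, hxn.ne']
    · have : A (((‖x‖⁻¹ : ℝ) : ℂ) • x) - (t : ℂ) • (((‖x‖⁻¹ : ℝ) : ℂ) • x)
          = ((‖x‖⁻¹ : ℝ) : ℂ) • (A x - (t : ℂ) • x) := by
        rw [map_smul, smul_sub, smul_comm]
      simp only [this, norm_smul]
      rw [Complex.norm_real, Real.norm_of_nonneg (by positivity), inv_mul_lt_iff₀ hxn, mul_comm]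
      exact hx
    · intro y hy
      constructor
      · have : ⟪y.2, x⟫ = 0 := by
          rw [Submodule.mem_orthogonal] at hxF
          exact hxF y.2 (Submodule.subset_span (by
            simp only [Finset.coe_image, Set.mem_image, Finset.mem_coe]
            exact ⟨y, hy, rfl⟩))
        simp only [inner_smul_right, this, mul_zero]
      · exact Nat.lt_succ_of_le (Finset.le_sup (f := Prod.fst) hy)
  obtain ⟨f, hf, hr⟩ := exists_seq_of_forall_finset_exists _ _ key
  have hmono : StrictMono (fun n => (f n).1) := fun m n h => (hr m n h).2
  refine ⟨fun n => (f n).2, fun n => (hf n).1, ?_, ?_⟩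
  · intro i j hij
    rcases lt_or_gt_of_ne hij with h | h
    · exact (hr i j h).1
    · exact inner_eq_zero_symm.1 (hr j i h).1
  · refine squeeze_zero (fun _ => norm_nonneg _) (fun n => ?_)
      (tendsto_one_div_add_atTop_nhds_zero_nat (𝕜 := ℝ))
    refine (hf n).2.le.trans ?_
    have : (n : ℝ) ≤ ((f n).1 : ℝ) := by exact_mod_cast hmono.id_le n
    gcongr

/-- A subspace on which an eigen-equation holds, off the essential spectrum, is
finite-dimensional. -/
theorem finite_mult (A : H →L[ℂ] H) (t : ℝ) (ht : t ∉ essSpec A) :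
    FiniteDimensional ℂ (Module.End.eigenspace (A : H →ₗ[ℂ] H) (t : ℂ)) := by
  obtain ⟨F, c, hF, hc, h⟩ := bddBelow_of_notMem_essSpec A t ht
  let φ : Module.End.eigenspace (A : H →ₗ[ℂ] H) (t : ℂ) →ₗ[ℂ] F :=
    (F.orthogonalProjectionOnto : H →ₗ[ℂ] F).comp (Submodule.subtype _)
  apply FiniteDimensional.of_injective φ
  rw [← LinearMap.ker_eq_bot, LinearMap.ker_eq_bot']
  rintro ⟨x, hx⟩ hφ
  have hxF : x ∈ Fᗮ := by
    have : F.orthogonalProjectionOnto x = 0 := hφ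
    exact Submodule.orthogonalProjectionOnto_eq_zero_iff.1 this
  have hx' : A x = (t : ℂ) • x := Module.End.mem_eigenspace_iff.1 hx
  have := h x hxF
  rw [hx', sub_self, norm_zero] at this
  have hx0 : ‖x‖ = 0 := le_antisymm (by nlinarith) (norm_nonneg x)
  exact Subtype.ext (norm_eq_zero.1 hx0)

/-- Approximate eigenvectors in a closed subspace give an eigenvector. -/
theorem exists_eigen_of_approx (A : H →L[ℂ] H) (t : ℝ) (ht : t ∉ essSpec A)
    (K : Submodule ℂ H) (hK : IsClosed (K : Set H)) (x : ℕ → H) (hxK : ∀ n, x n ∈ K)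
    (hx1 : ∀ n, ‖x n‖ = 1)
    (hx : Filter.Tendsto (fun n => A (x n) - (t : ℂ) • x n) Filter.atTop (nhds 0)) :
    ∃ v ∈ K, v ≠ 0 ∧ A v = (t : ℂ) • v := by
  obtain ⟨F, c, hF, hc, h⟩ := bddBelow_of_notMem_essSpec A t ht
  let a : ℕ → F := fun n => F.orthogonalProjectionOnto (x n)
  have ha : ∀ n, a n ∈ Metric.closedBall (0 : F) 1 := by
    intro n
    rw [mem_closedBall_zero_iff]
    exact (Submodule.norm_orthogonalProjectionOnto_apply_le F (x n)).trans (hx1 n).le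
  have : ProperSpace F := FiniteDimensional.proper ℂ F
  obtain ⟨a0, -, φ, hφ, hlim⟩ := (isCompact_closedBall (0 : F) 1).tendsto_subseq ha
  let B : H →L[ℂ] H := A - (t : ℂ) • ContinuousLinearMap.id ℂ H
  have hB : ∀ y, B y = A y - (t : ℂ) • y := fun y => rfl
  let b : ℕ → H := fun n => x (φ n) - (a (φ n) : H)
  have hbF : ∀ n, b n ∈ Fᗮ := fun n => Submodule.sub_starProjection_mem_orthogonal (K := F) _
  have hlim' : Filter.Tendsto (fun n => (a (φ n) : H)) Filter.atTop (nhds (a0 : H)) :=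
    (continuous_subtype_val.tendsto a0).comp hlim
  have hBb : Filter.Tendsto (fun n => B (b n)) Filter.atTop (nhds (0 - B a0)) := by
    simp only [b, map_sub]
    exact (hx.comp hφ.tendsto_atTop).sub ((B.continuous.tendsto _).comp hlim')
  have hbc : CauchySeq b := by
    rw [Metric.cauchySeq_iff']
    intro ε hε
    obtain ⟨N, hN⟩ := Metric.cauchySeq_iff'.1 hBb.cauchySeq (c * ε) (by positivity)
    refine ⟨N, fun n hn => ?_⟩
    have h1 := hN n hn
    rw [dist_eq_norm, ← map_sub] at h1
    have h2 := h (b n - b N) (Submodule.sub_mem _ (hbF n) (hbF N))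
    rw [← hB] at h2
    rw [dist_eq_norm]
    exact lt_of_mul_lt_mul_left (h2.trans_lt h1) hc.le
  obtain ⟨b0, hb0⟩ := cauchySeq_tendsto_of_complete hbc
  have hxlim : Filter.Tendsto (fun n => x (φ n)) Filter.atTop (nhds (b0 + a0)) := by
    have := hb0.add hlim'
    simpa [b] using this
  refine ⟨b0 + a0, hK.mem_of_tendsto hxlim (Filter.Eventually.of_forall fun n => hxK _), ?_, ?_⟩
  · intro h0
    have h1 := hxlim.norm
    simp only [hx1, h0, norm_zero] at h1
    exact one_ne_zero (tendsto_nhds_unique tendsto_const_nhds h1)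
  · have h1 := (B.continuous.tendsto _).comp hxlim
    have h2 : Filter.Tendsto (B ∘ fun n => x (φ n)) Filter.atTop (nhds 0) :=
      hx.comp hφ.tendsto_atTop
    have := tendsto_nhds_unique h1 h2
    rw [hB] at this
    exact sub_eq_zero.1 this

/-- If the quadratic form is somewhere positive on a closed invariant subspace, there is an
eigenvector with positive eigenvalue in it. -/
theorem exists_pos_eigen (A : H →L[ℂ] H) (hA : ∀ x y, ⟪A x, y⟫ = ⟪x, A y⟫)
    (hess : ∀ t : ℝ, 0 < t → t ∉ essSpec A)
    (K : Submodule ℂ H) (hK : IsClosed (K : Set H)) (hinv : ∀ x ∈ K, A x ∈ K)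
    (z : H) (hz : z ∈ K) (hpos : 0 < (⟪z, A z⟫).re) :
    ∃ t : ℝ, 0 < t ∧ ∃ v ∈ K, v ≠ 0 ∧ A v = (t : ℂ) • v := by
  let S : Set ℝ := {r | ∃ x ∈ K, ‖x‖ = 1 ∧ r = (⟪x, A x⟫).re}
  have hz0 : z ≠ 0 := by
    rintro rfl
    simp at hpos
  have hzn : 0 < ‖z‖ := norm_pos_iff.2 hz0
  have hscale : ∀ (r : ℝ) (x : H), (⟪(r : ℂ) • x, A ((r : ℂ) • x)⟫).re = r ^ 2 * (⟪x, A x⟫).re := by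
    intro r x
    rw [map_smul, inner_smul_left, inner_smul_right, Complex.conj_ofReal, Complex.re_ofReal_mul,
      Complex.re_ofReal_mul]
    ring
  have hmemS : ∀ x ∈ K, x ≠ 0 → (‖x‖⁻¹) ^ 2 * (⟪x, A x⟫).re ∈ S := by
    intro x hx hx0
    refine ⟨((‖x‖⁻¹ : ℝ) : ℂ) • x, K.smul_mem _ hx, ?_, (hscale _ _).symm⟩
    have : ‖x‖ ≠ 0 := norm_ne_zero_iff.2 hx0
    simp [norm_smul, this]
  have hSb : BddAbove S := by
    refine ⟨‖A‖, ?_⟩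
    rintro r ⟨x, -, hx, rfl⟩
    calc (⟪x, A x⟫).re ≤ ‖⟪x, A x⟫‖ := Complex.re_le_norm _
      _ ≤ ‖x‖ * ‖A x‖ := norm_inner_le_norm _ _
      _ ≤ ‖x‖ * (‖A‖ * ‖x‖) := by gcongr; exact A.le_opNorm x
      _ = ‖A‖ := by rw [hx]; ring
  have hzS := hmemS z hz hz0
  have hSne : S.Nonempty := ⟨_, hzS⟩
  let M := sSup S
  have hM : 0 < M := lt_of_lt_of_le (by positivity) (le_csSup hSb hzS)
  have hMle : ∀ x ∈ K, (⟪x, A x⟫).re ≤ M * ‖x‖ ^ 2 := by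
    intro x hx
    by_cases hx0 : x = 0
    · simp [hx0]
    have h1 := le_csSup hSb (hmemS x hx hx0)
    have hxn : 0 < ‖x‖ := norm_pos_iff.2 hx0
    rw [inv_pow, inv_mul_le_iff₀ (by positivity)] at h1
    linarith
  refine ⟨M, hM, ?_⟩
  let B : H →L[ℂ] H := (M : ℂ) • ContinuousLinearMap.id ℂ H - A
  have hB : ∀ y, B y = (M : ℂ) • y - A y := fun y => rfl
  have hBs : ∀ x y, ⟪B x, y⟫ = ⟪x, B y⟫ := by
    intro x y
    rw [hB, hB, inner_sub_left, inner_sub_right, hA, inner_smul_left, inner_smul_right,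
      Complex.conj_ofReal]
  have hBK : ∀ x ∈ K, B x ∈ K := fun x hx => K.sub_mem (K.smul_mem _ hx) (hinv x hx)
  have hBre : ∀ x, (⟪x, B x⟫).re = M * ‖x‖ ^ 2 - (⟪x, A x⟫).re := by
    intro x
    rw [hB, inner_sub_right, inner_smul_right, Complex.sub_re, Complex.re_ofReal_mul]
    congr 2
    have := inner_self_eq_norm_sq (𝕜 := ℂ) x
    simpa using this
  have hBpos : ∀ x ∈ K, 0 ≤ (⟪x, B x⟫).re := by
    intro x hx
    rw [hBre]
    linarith [hMle x hx]
  let s : ℝ := 1 / (‖B‖ + 1)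
  have hs : 0 < s := by positivity
  have hsB : s * ‖B‖ ≤ 1 := by
    have : 0 ≤ ‖B‖ := norm_nonneg _
    rw [one_div_mul_eq_div, div_le_one (by positivity)]
    linarith
  have hCS : ∀ x ∈ K, s * ‖B x‖ ^ 2 ≤ (⟪x, B x⟫).re := by
    intro x hx
    have h1 := hBpos (x - (s : ℂ) • B x) (K.sub_mem hx (K.smul_mem _ (hBK x hx)))
    have hself : (⟪B x, B x⟫).re = ‖B x‖ ^ 2 := by
      have := inner_self_eq_norm_sq (𝕜 := ℂ) (B x)
      simpa using this
    have e1 : (⟪x - (s : ℂ) • B x, B (x - (s : ℂ) • B x)⟫).re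
        = (⟪x, B x⟫).re - 2 * s * ‖B x‖ ^ 2 + s ^ 2 * (⟪B x, B (B x)⟫).re := by
      rw [map_sub, map_smul, inner_sub_left, inner_sub_right, inner_sub_right, inner_smul_left,
        inner_smul_left, inner_smul_right, inner_smul_right, Complex.conj_ofReal, ← hBs x (B x)]
      simp only [Complex.sub_re, Complex.re_ofReal_mul, hself]
      ring
    have h2 : (⟪B x, B (B x)⟫).re ≤ ‖B‖ * ‖B x‖ ^ 2 := by
      calc _ ≤ ‖⟪B x, B (B x)⟫‖ := Complex.re_le_norm _
        _ ≤ ‖B x‖ * ‖B (B x)‖ := norm_inner_le_norm _ _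
        _ ≤ ‖B x‖ * (‖B‖ * ‖B x‖) := by gcongr; exact B.le_opNorm _
        _ = _ := by ring
    rw [e1] at h1
    have h3 : s ^ 2 * (⟪B x, B (B x)⟫).re ≤ s * ‖B x‖ ^ 2 := by
      calc _ ≤ s ^ 2 * (‖B‖ * ‖B x‖ ^ 2) := by gcongr
        _ = (s * ‖B‖) * (s * ‖B x‖ ^ 2) := by ring
        _ ≤ 1 * (s * ‖B x‖ ^ 2) := by gcongr
        _ = _ := one_mul _
    linarith
  have hseq : ∀ n : ℕ, ∃ x ∈ K, ‖x‖ = 1 ∧ M - 1 / ((n : ℝ) + 1) < (⟪x, A x⟫).re := by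
    intro n
    have : M - 1 / ((n : ℝ) + 1) < sSup S := by
      have : 0 < 1 / ((n : ℝ) + 1) := by positivity
      change M - _ < M
      linarith
    obtain ⟨r, ⟨x, hx, hx1, rfl⟩, hr⟩ := exists_lt_of_lt_csSup hSne this
    exact ⟨x, hx, hx1, hr⟩
  choose x hxK hx1 hxM using hseq
  refine exists_eigen_of_approx A M (hess M hM) K hK x hxK hx1 ?_
  have hsq : Filter.Tendsto (fun n => ‖B (x n)‖ ^ 2) Filter.atTop (nhds 0) := by
    have h0 := (tendsto_one_div_add_atTop_nhds_zero_nat (𝕜 := ℝ)).const_mul s⁻¹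
    rw [mul_zero] at h0
    refine squeeze_zero (fun _ => by positivity) (fun n => ?_) h0
    have h1 := hCS (x n) (hxK n)
    rw [hBre, hx1] at h1
    have h2 := hxM n
    rw [← div_eq_inv_mul, le_div_iff₀ hs]
    linarith
  have hn : Filter.Tendsto (fun n => ‖B (x n)‖) Filter.atTop (nhds 0) := by
    have := hsq.sqrt
    simpa [Real.sqrt_sq] using this
  have := (tendsto_zero_iff_norm_tendsto_zero.2 hn).neg
  simpa [hB] using this

/-- Eigenvectors of a symmetric operator to distinct real eigenvalues are orthogonal. -/
theorem eigen_orth (A : H →L[ℂ] H) (hA : ∀ x y, ⟪A x, y⟫ = ⟪x, A y⟫) (s t : ℝ) (hst : s ≠ t)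
    (u v : H) (hu : A u = (s : ℂ) • u) (hv : A v = (t : ℂ) • v) : ⟪u, v⟫ = 0 := by
  have h := hA u v
  rw [hu, hv, inner_smul_left, inner_smul_right, Complex.conj_ofReal] at h
  have h2 : ((s : ℂ) - t) * ⟪u, v⟫ = 0 := by rw [sub_mul, h, sub_self]
  rcases mul_eq_zero.1 h2 with h3 | h3
  · exact absurd (by exact_mod_cast sub_eq_zero.1 h3) hst
  · exact h3

/-- Abstract form of the result. -/
theorem pos_eigen_seq (A : H →L[ℂ] H) (hA : ∀ x y, ⟪A x, y⟫ = ⟪x, A y⟫)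
    (hess : ∀ t : ℝ, 0 < t → t ∉ essSpec A)
    (f : ℕ → H) (hf : ∀ i j, i ≠ j → ⟪f i, A (f j)⟫ = 0) (hfp : ∀ i, 0 < (⟪f i, A (f i)⟫).re) :
    ∃ p : ℕ → ℝ, Function.Injective p ∧
      (∀ n, 0 < p n ∧ ∃ v : H, v ≠ 0 ∧ A v = (p n : ℂ) • v) ∧
      Filter.Tendsto p Filter.atTop (nhds 0) := by
  let S : Set ℝ := {t | 0 < t ∧ ∃ v : H, v ≠ 0 ∧ A v = (t : ℂ) • v}
  have hSinf : S.Infinite := by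
    intro hfin
    have : Finite S := hfin
    let W : Submodule ℂ H := ⨆ t : S, Module.End.eigenspace (A : H →ₗ[ℂ] H) ((t : ℝ) : ℂ)
    have hfd : ∀ t : S, FiniteDimensional ℂ
        (Module.End.eigenspace (A : H →ₗ[ℂ] H) ((t : ℝ) : ℂ)) :=
      fun t => finite_mult A t (hess t t.2.1)
    have hW : FiniteDimensional ℂ W := Submodule.finiteDimensional_iSup _
    have hWinv : ∀ w ∈ W, A w ∈ W := by
      intro w hw
      have hle : W ≤ W.comap (A : H →ₗ[ℂ] H) := by
        refine iSup_le fun t v hv => ?_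
        have hv' : A v = ((t : ℝ) : ℂ) • v := Module.End.mem_eigenspace_iff.1 hv
        have hvW : v ∈ W := (le_iSup (fun t : S =>
          Module.End.eigenspace (A : H →ₗ[ℂ] H) ((t : ℝ) : ℂ)) t) hv
        change A v ∈ W
        rw [hv']
        exact W.smul_mem _ hvW
      exact hle hw
    have hKinv : ∀ x ∈ Wᗮ, A x ∈ Wᗮ := by
      intro x hx
      rw [Submodule.mem_orthogonal] at hx ⊢
      intro w hw
      rw [← hA]
      exact hx _ (hWinv w hw)
    let N := Module.finrank ℂ W
    let g : (Fin (N + 1) → ℂ) →ₗ[ℂ] H := Fintype.linearCombination ℂ (fun i : Fin (N + 1) => f i)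
    let φ : (Fin (N + 1) → ℂ) →ₗ[ℂ] W := (W.orthogonalProjectionOnto : H →ₗ[ℂ] W).comp g
    have hker : LinearMap.ker φ ≠ ⊥ := LinearMap.ker_ne_bot_of_finrank_lt (by simp [N])
    obtain ⟨c, hc, hc0⟩ := Submodule.exists_mem_ne_zero_of_ne_bot hker
    have hz : g c ∈ Wᗮ := by
      have : W.orthogonalProjectionOnto (g c) = 0 := hc
      exact Submodule.orthogonalProjectionOnto_eq_zero_iff.1 this
    have hform : (⟪g c, A (g c)⟫).re = ∑ i, ‖c i‖ ^ 2 * (⟪f i, A (f i)⟫).re := by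
      have hg : g c = ∑ i, c i • f i := by
        simp [g, Fintype.linearCombination_apply]
      rw [hg, map_sum, sum_inner, Complex.re_sum]
      refine Finset.sum_congr rfl fun i _ => ?_
      rw [inner_sum, Finset.sum_eq_single i]
      · rw [map_smul, inner_smul_left, inner_smul_right, ← mul_assoc, Complex.conj_mul',
          ← Complex.ofReal_pow, Complex.re_ofReal_mul]
      · intro j _ hj
        rw [map_smul, inner_smul_left, inner_smul_right, hf, mul_zero, mul_zero]
        exact fun h => hj (Fin.ext h.symm)
      · simp
    have hpos : 0 < (⟪g c, A (g c)⟫).re := by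
      rw [hform]
      obtain ⟨i, hi⟩ := Function.ne_iff.1 hc0
      refine Finset.sum_pos' (fun j _ => mul_nonneg (by positivity) (hfp j).le)
        ⟨i, Finset.mem_univ i, mul_pos (pow_pos (norm_pos_iff.2 hi) 2) (hfp i)⟩
    obtain ⟨t, ht, v, hvK, hv0, hv⟩ := exists_pos_eigen A hA hess Wᗮ
      (Submodule.isClosed_orthogonal W) hKinv _ hz hpos
    have hvW : v ∈ W := (le_iSup (fun t : S =>
      Module.End.eigenspace (A : H →ₗ[ℂ] H) ((t : ℝ) : ℂ)) ⟨t, ht, v, hv0, hv⟩)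
        (Module.End.mem_eigenspace_iff.2 hv)
    exact hv0 (inner_self_eq_zero.1 ((Submodule.mem_orthogonal _ _).1 hvK v hvW))
  have hbd : ∀ t ∈ S, t ≤ ‖A‖ := by
    rintro t ⟨ht, v, hv0, hv⟩
    have h1 := A.le_opNorm v
    rw [hv, norm_smul, Complex.norm_real, Real.norm_of_nonneg ht.le] at h1
    exact le_of_mul_le_mul_right h1 (norm_pos_iff.2 hv0)
  have hfinε : ∀ ε : ℝ, 0 < ε → (S ∩ Set.Ici ε).Finite := by
    intro ε hε
    by_contra hinf
    have hinf : (S ∩ Set.Ici ε).Infinite := hinf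
    let r := hinf.natEmbedding
    have hr : ∀ n, ((r n : ℝ)) ∈ Set.Icc ε ‖A‖ := fun n => ⟨(r n).2.2, hbd _ (r n).2.1⟩
    obtain ⟨t, ht, φ, hφ, hlim⟩ := isCompact_Icc.tendsto_subseq hr
    apply hess t (hε.trans_le ht.1)
    have hv : ∀ n, ∃ v : H, ‖v‖ = 1 ∧ A v = ((r (φ n) : ℝ) : ℂ) • v := by
      intro n
      obtain ⟨-, v, hv0, hv⟩ := (r (φ n)).2.1
      have : ‖v‖ ≠ 0 := norm_ne_zero_iff.2 hv0
      refine ⟨((‖v‖⁻¹ : ℝ) : ℂ) • v, by simp [norm_smul, this], ?_⟩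
      rw [map_smul, hv, smul_comm]
    choose v hv1 hv using hv
    refine ⟨v, hv1, ?_, ?_⟩
    · intro i j hij
      refine eigen_orth A hA _ _ ?_ _ _ (hv i) (hv j)
      intro h
      exact hij (hφ.injective (r.injective (Subtype.ext h)))
    · have e1 : ∀ n, ‖A (v n) - (t : ℂ) • v n‖ = |(r (φ n) : ℝ) - t| := by
        intro n
        rw [hv, ← sub_smul, norm_smul, hv1, mul_one, ← Complex.ofReal_sub, Complex.norm_real,
          Real.norm_eq_abs]
      simp only [e1]
      have := (hlim.sub_const t).abs
      simpa using this
  let p := hSinf.natEmbedding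
  have hpinj : Function.Injective (fun n => (p n : ℝ)) :=
    Subtype.val_injective.comp p.injective
  refine ⟨fun n => (p n : ℝ), hpinj, fun n => (p n).2, ?_⟩
  rw [Metric.tendsto_nhds]
  intro ε hε
  have h1 : {n | (p n : ℝ) ∈ S ∩ Set.Ici ε}.Finite :=
    (hfinε ε hε).preimage hpinj.injOn
  rw [← Nat.cofinite_eq_atTop]
  refine h1.subset ?_
  intro n hn
  simp only [Set.mem_compl_iff, Set.mem_setOf_eq, Real.dist_eq, sub_zero, not_lt] at hn
  refine ⟨(p n).2, ?_⟩
  rwa [abs_of_pos (p n).2.1] at hn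

/-- Infinitely many far apart edges. -/
theorem exists_far_edges {V : Type*} [Infinite V] (E : V → V → ℝ)
    (hE_symm : ∀ x y, E x y = E y x)
    (hloc : ∀ x, {y | 0 < E x y}.Finite) (hnb : ∀ x, ∃ y, 0 < E x y) :
    ∃ w : ℕ → V × V, (∀ n, 0 < E (w n).1 (w n).2) ∧
      ∀ m n, m ≠ n → ¬ 0 < E (w m).1 (w n).1 ∧ ¬ 0 < E (w m).1 (w n).2 ∧
        ¬ 0 < E (w m).2 (w n).1 ∧ ¬ 0 < E (w m).2 (w n).2 := by
  have key : ∀ s : Finset (V × V), (∀ x ∈ s, 0 < E x.1 x.2) →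
      ∃ y : V × V, 0 < E y.1 y.2 ∧ ∀ x ∈ s, (¬ 0 < E x.1 y.1 ∧ ¬ 0 < E x.1 y.2 ∧
        ¬ 0 < E x.2 y.1 ∧ ¬ 0 < E x.2 y.2) := by
    intro s _
    let B : Set V := ⋃ x ∈ s, ({y | 0 < E x.1 y} ∪ {y | 0 < E x.2 y})
    have hB : B.Finite := s.finite_toSet.biUnion fun x _ => (hloc _).union (hloc _)
    let C : Set V := B ∪ ⋃ b ∈ B, {y | 0 < E b y}
    have hC : C.Finite := hB.union (hB.biUnion fun x _ => hloc _)
    obtain ⟨x, hx⟩ := hC.exists_notMem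
    obtain ⟨y, hy⟩ := hnb x
    have hxB : x ∉ B := fun h => hx (Or.inl h)
    have hyB : y ∉ B := fun h => hx (Or.inr (Set.mem_biUnion h (by
      change 0 < E y x
      rwa [hE_symm])))
    refine ⟨(x, y), hy, fun z hz => ⟨?_, ?_, ?_, ?_⟩⟩
    · exact fun h => hxB (Set.mem_biUnion hz (Or.inl h))
    · exact fun h => hyB (Set.mem_biUnion hz (Or.inl h))
    · exact fun h => hxB (Set.mem_biUnion hz (Or.inr h))
    · exact fun h => hyB (Set.mem_biUnion hz (Or.inr h))
  obtain ⟨w, hw, hr⟩ := exists_seq_of_forall_finset_exists _ _ key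
  refine ⟨w, hw, fun m n hmn => ?_⟩
  rcases lt_or_gt_of_ne hmn with h | h
  · exact hr m n h
  · obtain ⟨h1, h2, h3, h4⟩ := hr n m h
    rw [hE_symm] at h1 h2 h3 h4
    exact ⟨h1, h3, h2, h4⟩

/-- If the essential spectrum of the normalized Laplacian `Δ_η` of an infinite
connected locally finite graph equals `{1}`, then `Δ_η` possesses two infinite
sequences of eigenvalues `(λ_n⁺)` and `(λ_n⁻)` with `λ_n⁺ > 1` and `λ_n⁻ < 1`,
both converging to `1`.  The operator `Δ_η` is represented as a bounded
self-adjoint operator `T` on the Hilbert space `ℓ²(V,η)`, via the family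
`e : V → H` of (images of) Dirac masses: `⟨e x, e y⟩ = η(x) δ_{x,y}`,
`⟨e x, T (e y)⟩ = η(x) δ_{x,y} - E(x,y)`, with total span dense. -/
theorem eigenvalues_above_and_below_one
    {V : Type*} [Countable V] [Infinite V] [DecidableEq V]
    (E : V → V → ℝ) (η : V → ℝ)
    (hE_symm : ∀ x y, E x y = E y x)
    (hE_simple : ∀ x y, E x y = 0 ∨ E x y = 1)
    (hE_diag : ∀ x, E x x = 0)
    (hloc : ∀ x, {y | 0 < E x y}.Finite)
    (hconn : ∀ x y : V, Relation.ReflTransGen (fun a b => 0 < E a b) x y)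
    (hη : ∀ x, η x = ∑' y, E x y)
    (hηpos : ∀ x, 0 < η x)
    (T : H →L[ℂ] H) (hT : IsSelfAdjoint T)
    (e : V → H)
    (he_inner : ∀ x y, ⟪e x, e y⟫ = if x = y then (η x : ℂ) else 0)
    (he_T : ∀ x y, ⟪e x, T (e y)⟫ =
      (if x = y then (η x : ℂ) else 0) - (E x y : ℂ))
    (hdense : (Submodule.span ℂ (Set.range e)).topologicalClosure = ⊤)
    (hess : essSpec T = {1}) :
    ∃ p q : ℕ → ℝ, Function.Injective p ∧ Function.Injective q ∧
      (∀ n, 1 < p n ∧ ∃ v : H, v ≠ 0 ∧ T v = (p n : ℂ) • v) ∧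
      (∀ n, q n < 1 ∧ ∃ v : H, v ≠ 0 ∧ T v = (q n : ℂ) • v) ∧
      Filter.Tendsto p Filter.atTop (nhds 1) ∧
      Filter.Tendsto q Filter.atTop (nhds 1) := by
  have hnb : ∀ x, ∃ y, 0 < E x y := by
    intro x
    by_contra hcon
    push Not at hcon
    have h0 : ∀ y, E x y = 0 := by
      intro y
      rcases hE_simple x y with h | h
      · exact h
      · have := hcon y
        linarith
    have := hηpos x
    rw [hη x] at this
    simp [h0] at this
  obtain ⟨w, hw, hr⟩ := exists_far_edges E hE_symm hloc hnb
  have hz : ∀ x y, ¬ 0 < E x y → E x y = 0 := by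
    intro x y h
    rcases hE_simple x y with h' | h'
    · exact h'
    · rw [h'] at h
      norm_num at h
  have hTs : ∀ x y, ⟪T x, y⟫ = ⟪x, T y⟫ := hT.isSymmetric
  let A : H →L[ℂ] H := T - ContinuousLinearMap.id ℂ H
  have hAa : ∀ y, A y = T y - y := fun y => rfl
  have hAs : ∀ x y, ⟪A x, y⟫ = ⟪x, A y⟫ := by
    intro x y
    rw [hAa, hAa, inner_sub_left, inner_sub_right, hTs]
  have hAe : ∀ x y, ⟪e x, A (e y)⟫ = -(E x y : ℂ) := by
    intro x y
    rw [hAa, inner_sub_right, he_T, he_inner]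
    ring
  have hess1 : ∀ t : ℝ, t ≠ 1 → t ∉ essSpec T := by
    intro t ht h
    rw [hess] at h
    exact ht h
  obtain ⟨p, hpi, hp, hpl⟩ := pos_eigen_seq A hAs (by
      rintro t ht ⟨u, hu1, hu2, hu3⟩
      refine hess1 (1 + t) (by linarith) ⟨u, hu1, hu2, ?_⟩
      refine hu3.congr fun n => ?_
      rw [hAa]
      congr 1
      push_cast
      module)
    (fun n => e (w n).1 - e (w n).2) (by
      intro i j hij
      obtain ⟨h1, h2, h3, h4⟩ := hr i j hij
      simp only [map_sub, inner_sub_left, inner_sub_right, hAe, hz _ _ h1, hz _ _ h2, hz _ _ h3,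
        hz _ _ h4]
      simp) (by
      intro i
      have h := hw i
      simp only [map_sub, inner_sub_left, inner_sub_right, hAe, hE_diag, hE_symm (w i).2 (w i).1]
      simp
      linarith)
  obtain ⟨q, hqi, hq, hql⟩ := pos_eigen_seq (-A) (by
      intro x y
      simp only [ContinuousLinearMap.neg_apply, inner_neg_left, inner_neg_right, hAs]) (by
      rintro t ht ⟨u, hu1, hu2, hu3⟩
      refine hess1 (1 - t) (by linarith) ⟨u, hu1, hu2, ?_⟩
      refine hu3.congr fun n => ?_
      rw [ContinuousLinearMap.neg_apply, hAa, ← norm_neg]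
      congr 1
      push_cast
      module)
    (fun n => e (w n).1 + e (w n).2) (by
      intro i j hij
      obtain ⟨h1, h2, h3, h4⟩ := hr i j hij
      simp only [ContinuousLinearMap.neg_apply, inner_neg_right, map_add, inner_add_left,
        inner_add_right, hAe, hz _ _ h1, hz _ _ h2, hz _ _ h3, hz _ _ h4]
      simp) (by
      intro i
      have h := hw i
      simp only [ContinuousLinearMap.neg_apply, inner_neg_right, map_add, inner_add_left,
        inner_add_right, hAe, hE_diag, hE_symm (w i).2 (w i).1]
      simp
      linarith)
  refine ⟨fun n => 1 + p n, fun n => 1 - q n, ?_, ?_, ?_, ?_, ?_, ?_⟩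
  · intro a b hab
    exact hpi (by simpa using hab)
  · intro a b hab
    exact hqi (by simpa using hab)
  · intro n
    obtain ⟨h0, v, hv0, hv⟩ := hp n
    refine ⟨by linarith, v, hv0, ?_⟩
    rw [hAa, sub_eq_iff_eq_add] at hv
    rw [hv]
    push_cast
    module
  · intro n
    obtain ⟨h0, v, hv0, hv⟩ := hq n
    refine ⟨by linarith, v, hv0, ?_⟩
    rw [ContinuousLinearMap.neg_apply, hAa, neg_sub, sub_eq_iff_eq_add, ← sub_eq_iff_eq_add'] at hv
    rw [← hv]
    push_cast
    module
  · simpa using hpl.const_add 1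
  · simpa using hql.const_sub 1
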